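/- (Theorem 12) For every n ≥ 3, the query set produced by Algorithm 5 on input n satisfies |Y⁽ⁿ⁻²⁾| = 2^⌈n/2⌉ + 2^⌊n/2⌋ − 1; in particular its cardinality is O(√(2^n)). -/

import Mathlib

/-- The sets `Y⁽ᵏ⁾` of Algorithm 5; on input `n` the algorithm outputs `Y⁽ⁿ⁻²⁾`. -/
def Y5 : ℕ → Finset ℕ
  | 0 => {0, 1, 2}
  | k + 1 =>
      Y5 k ∪
        (((Y5 k).filter (fun y => Nat.size y = k + 1)).image
            (fun y => 2 ^ (k + 2) ^^^ y) ∪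
          ((Y5 k).filter (fun y => Nat.size y = k + 1)).image
            (fun y => 2 ^ (k + 2) ^^^ 2 ^ k ^^^ y))

theorem Nat.size_eq_succ_iff {x m : ℕ} :
    x.size = m + 1 ↔ x < 2 ^ (m + 1) ∧ x.testBit m = true := by
  constructor
  · intro h
    have hlt : x < 2 ^ (m + 1) := Nat.size_le.mp h.le
    have hle : 2 ^ m ≤ x := Nat.lt_size.mp (by omega)
    refine ⟨hlt, ?_⟩
    obtain ⟨r, rfl⟩ := Nat.exists_eq_add_of_le hle
    have hr : r < 2 ^ m := by rw [pow_succ] at hlt; omega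
    rw [Nat.testBit_two_pow_add_eq, Nat.testBit_lt_two_pow hr]
    rfl
  · rintro ⟨hlt, hbit⟩
    exact le_antisymm (Nat.size_le.mpr hlt) (Nat.lt_size.mpr (Nat.ge_two_pow_of_testBit hbit))

theorem Nat.size_two_pow_xor {x m : ℕ} (hx : x < 2 ^ m) :
    (2 ^ m ^^^ x).size = m + 1 := by
  refine Nat.size_eq_succ_iff.mpr ⟨Nat.xor_lt_two_pow ?_ ?_, ?_⟩
  · exact Nat.pow_lt_pow_right (by norm_num) (Nat.lt_succ_self m)
  · exact hx.trans (Nat.pow_lt_pow_right (by norm_num) (Nat.lt_succ_self m))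
  · simp [Nat.testBit_xor, Nat.testBit_lt_two_pow hx]

/-- The set `Z⁽ᵏ⁺¹⁾` of elements that step `k + 1` of Algorithm 5 adds to `Y⁽ᵏ⁾`. -/
def Z5 (k : ℕ) : Finset ℕ :=
  ((Y5 k).filter (fun y => Nat.size y = k + 1)).image (fun y => 2 ^ (k + 2) ^^^ y) ∪
    ((Y5 k).filter (fun y => Nat.size y = k + 1)).image (fun y => 2 ^ (k + 2) ^^^ 2 ^ k ^^^ y)

theorem Y5_succ (k : ℕ) : Y5 (k + 1) = Y5 k ∪ Z5 k := rfl

theorem size_of_mem_Z5 {k x : ℕ} (hx : x ∈ Z5 k) : x.size = k + 3 := by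
  have lt_of_size {y : ℕ} (hy : y.size = k + 1) : y < 2 ^ (k + 2) :=
    Nat.size_le.mp (by omega)
  simp only [Z5, Finset.mem_union, Finset.mem_image, Finset.mem_filter] at hx
  obtain ⟨y, ⟨-, hy⟩, rfl⟩ | ⟨y, ⟨-, hy⟩, rfl⟩ := hx
  · exact Nat.size_two_pow_xor (lt_of_size hy)
  · rw [Nat.xor_assoc]
    exact Nat.size_two_pow_xor (Nat.xor_lt_two_pow
      (Nat.pow_lt_pow_right (by norm_num) (by omega)) (lt_of_size hy))

theorem card_Z5 (k : ℕ) :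
    (Z5 k).card = 2 * ((Y5 k).filter (fun y => Nat.size y = k + 1)).card := by
  rw [Z5, Finset.card_union_of_disjoint,
    Finset.card_image_of_injective _ (fun _ _ h => Nat.xor_right_injective h),
    Finset.card_image_of_injective _ (fun _ _ h => Nat.xor_right_injective h), two_mul]
  simp only [Finset.disjoint_left, Finset.mem_image, Finset.mem_filter]
  rintro _ ⟨y, ⟨-, hy⟩, rfl⟩ ⟨z, ⟨-, hz⟩, h⟩
  have hbit := congrArg (fun x => x.testBit k) h
  simp [Nat.testBit_xor, (Nat.size_eq_succ_iff.mp hy).2,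
    (Nat.size_eq_succ_iff.mp hz).2] at hbit

theorem size_le_of_mem_Y5 {k x : ℕ} (hx : x ∈ Y5 k) : x.size ≤ k + 2 := by
  induction k with
  | zero =>
    simp only [Y5, Finset.mem_insert, Finset.mem_singleton] at hx
    obtain rfl | rfl | rfl := hx <;> exact Nat.size_le.mpr (by norm_num)
  | succ k ih =>
    rw [Y5_succ, Finset.mem_union] at hx
    obtain hx | hx := hx
    · have := ih hx
      omega
    · exact (size_of_mem_Z5 hx).le

theorem filter_size_Y5_succ (k : ℕ) :
    (Y5 (k + 1)).filter (fun y => Nat.size y = k + 2) =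
      (Y5 k).filter (fun y => Nat.size y = k + 2) := by
  ext x
  simp only [Y5_succ, Finset.mem_filter, Finset.mem_union]
  refine ⟨?_, fun h => ⟨Or.inl h.1, h.2⟩⟩
  rintro ⟨hx | hx, hs⟩
  · exact ⟨hx, hs⟩
  · have := size_of_mem_Z5 hx
    omega

theorem filter_size_Y5_succ_eq_Z5 (k : ℕ) :
    (Y5 (k + 1)).filter (fun y => Nat.size y = k + 3) = Z5 k := by
  ext x
  simp only [Y5_succ, Finset.mem_filter, Finset.mem_union]
  refine ⟨?_, fun h => ⟨Or.inr h, size_of_mem_Z5 h⟩⟩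
  rintro ⟨hx | hx, hs⟩
  · have := size_le_of_mem_Y5 hx
    omega
  · exact hx

theorem card_filter_size_Y5 (k : ℕ) :
    ((Y5 k).filter (fun y => Nat.size y = k + 1)).card = 2 ^ (k / 2) ∧
      ((Y5 k).filter (fun y => Nat.size y = k + 2)).card = 2 ^ ((k + 1) / 2) := by
  induction k with
  | zero => exact ⟨rfl, rfl⟩
  | succ k ih =>
    refine ⟨by rw [filter_size_Y5_succ, ih.2], ?_⟩
    rw [filter_size_Y5_succ_eq_Z5, card_Z5, ih.1, ← pow_succ']
    congr 1
    omega

theorem card_Y5_add_one (k : ℕ) :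
    (Y5 k).card + 1 = 2 ^ ((k + 3) / 2) + 2 ^ ((k + 2) / 2) := by
  induction k with
  | zero => rfl
  | succ k ih =>
    have hdisj : Disjoint (Y5 k) (Z5 k) := Finset.disjoint_left.mpr fun x hY hZ => by
      have := size_le_of_mem_Y5 hY
      have := size_of_mem_Z5 hZ
      omega
    rw [Y5_succ, Finset.card_union_of_disjoint hdisj, card_Z5, (card_filter_size_Y5 k).1]
    have h₁ : (k + 2) / 2 = k / 2 + 1 := by omega
    have h₂ : (k + 1 + 3) / 2 = k / 2 + 2 := by omega
    rw [h₁] at ih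
    rw [h₂, show k + 1 + 2 = k + 3 from rfl]
    simp only [pow_succ] at ih ⊢
    omega

/-- Theorem 12: for every `n ≥ 3`, the query set `Y⁽ⁿ⁻²⁾` produced by
Algorithm 5 on input `n` satisfies `|Y⁽ⁿ⁻²⁾| = 2^⌈n/2⌉ + 2^⌊n/2⌋ − 1`
(which is `O(√(2^n))`). -/
theorem stmt_13 (n : ℕ) (hn : 3 ≤ n) :
    (Y5 (n - 2)).card = 2 ^ ((n + 1) / 2) + 2 ^ (n / 2) - 1 := by
  obtain ⟨k, rfl⟩ := Nat.exists_eq_add_of_le' (show 2 ≤ n by omega)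
  have h := card_Y5_add_one k
  rw [Nat.add_sub_cancel]
  exact Nat.eq_sub_of_add_eq h
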